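/- For the simple random walk on the diamond graph (the lattice Z^2 rotated by π/4 and scaled by 1/√2) started at the origin, the probability that at its first return time to the horizontal axis Z×{0} it lands at the point (k,0) equals 2/(π(4k²−1)) for k ≠ 0, and equals 1 − 2/π for k = 0. -/

import Mathlib

open Finset

/-- Steps of the simple random walk on the diamond graph
`𝒟 = e^{iπ/4}·2^{-1/2}·ℤ²`, written in doubled coordinates (so that all
vertices are integer points): each step is `(±1, ±1)`. -/
def diamondSteps : Finset (ℤ × ℤ) := {(1, 1), (1, -1), (-1, 1), (-1, -1)}

/-- Position after the first `m` steps of a length-`n` walk (in doubled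
coordinates), started at the origin. -/
def walkPos {n : ℕ} (w : Fin n → diamondSteps) (m : ℕ) : ℤ × ℤ :=
  ∑ i ∈ Finset.univ.filter (fun i : Fin n => (i : ℕ) < m), ((w i : ℤ × ℤ))

/-- The number of length-`n` step sequences of the simple random walk on the
diamond graph started at the origin whose first visit to the horizontal axis
`ℤ × {0}` (at a positive time) happens exactly at time `n`, landing at the
point `(k, 0)` (i.e. `(2k, 0)` in doubled coordinates). -/
noncomputable def firstReturnCount (n : ℕ) (k : ℤ) : ℕ :=
  Nat.card {w : Fin n → diamondSteps //
    (∀ m : ℕ, 0 < m → m < n → (walkPos w m).2 ≠ 0) ∧ walkPos w n = (2 * k, 0)}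

/-- Number of walks from `v` first hitting the axis at time `n`, at `(2k,0)`. -/
noncomputable def dCnt (n : ℕ) (k : ℤ) (v : ℤ × ℤ) : ℝ :=
  open Classical in
  ∑ w : Fin n → diamondSteps,
    if (∀ m : ℕ, 0 < m → m < n → (v + walkPos w m).2 ≠ 0) ∧ v + walkPos w n = (2 * k, 0)
    then 1 else 0

lemma walkPos_zero' {n : ℕ} (w : Fin n → diamondSteps) : walkPos w 0 = 0 := by
  simp [walkPos]

lemma walkPos_cons {n : ℕ} (s : diamondSteps) (w : Fin n → diamondSteps) (m : ℕ) :
    walkPos (Fin.cons s w : Fin (n + 1) → diamondSteps) (m + 1) = (s : ℤ × ℤ) + walkPos w m := by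
  unfold walkPos
  rw [Finset.sum_filter, Finset.sum_filter, Fin.sum_univ_succ]
  simp

lemma dCnt_eq (n : ℕ) (k : ℤ) : (firstReturnCount n k : ℝ) = dCnt n k 0 := by
  classical
  unfold firstReturnCount dCnt
  rw [Nat.card_eq_fintype_card, Fintype.card_subtype]
  simp

lemma sum_steps (f : ℤ × ℤ → ℝ) :
    ∑ s : diamondSteps, f s = f (1, 1) + f (1, -1) + f (-1, 1) + f (-1, -1) := by
  rw [Finset.sum_coe_sort diamondSteps f]
  unfold diamondSteps
  rw [Finset.sum_insert (by decide), Finset.sum_insert (by decide), Finset.sum_insert (by decide),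
    Finset.sum_singleton]
  ring

lemma dCnt_one (k : ℤ) (v : ℤ × ℤ) :
    dCnt 1 k v = ∑ s : diamondSteps, if v + (s : ℤ × ℤ) = (2 * k, 0) then 1 else 0 := by
  classical
  unfold dCnt
  rw [← (Fin.consEquiv (fun _ : Fin 1 => diamondSteps)).sum_comp, Fintype.sum_prod_type]
  refine Finset.sum_congr rfl fun s _ => ?_
  simp only [Fintype.sum_unique]
  have h := walkPos_cons s (default : Fin 0 → diamondSteps) 0
  rw [walkPos_zero', add_zero] at h
  simp only [zero_add] at h
  erw [h]
  have : ∀ m : ℕ, 0 < m → ¬ m < 1 := by intro m; omega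
  congr 1
  simp only [eq_iff_iff, and_iff_right_iff_imp]
  intro _ m h1 h2
  omega

lemma dCnt_succ (n : ℕ) (k : ℤ) (v : ℤ × ℤ) :
    dCnt (n + 2) k v = ∑ s : diamondSteps,
      if (v + (s : ℤ × ℤ)).2 = 0 then 0 else dCnt (n + 1) k (v + (s : ℤ × ℤ)) := by
  classical
  unfold dCnt
  rw [← (Fin.consEquiv (fun _ : Fin (n + 2) => diamondSteps)).sum_comp, Fintype.sum_prod_type]
  refine Finset.sum_congr rfl fun s _ => ?_
  have key : ∀ w : Fin (n + 1) → diamondSteps,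
      ((∀ m : ℕ, 0 < m → m < n + 2 →
        (v + walkPos (Fin.cons s w : Fin (n + 2) → diamondSteps) m).2 ≠ 0) ∧
        v + walkPos (Fin.cons s w : Fin (n + 2) → diamondSteps) (n + 2) = (2 * k, 0)) ↔
      ((v + (s : ℤ × ℤ)).2 ≠ 0 ∧ (∀ m : ℕ, 0 < m → m < n + 1 →
        (v + (s : ℤ × ℤ) + walkPos w m).2 ≠ 0) ∧ v + (s : ℤ × ℤ) + walkPos w (n + 1) = (2 * k, 0)) := by
    intro w
    rw [walkPos_cons s w (n + 1), ← add_assoc, ← and_assoc]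
    refine and_congr_left fun _ => ⟨fun h => ⟨?_, fun m h1 h2 => ?_⟩, fun h m h1 h2 => ?_⟩
    · have := h 1 (by omega) (by omega)
      rwa [walkPos_cons s w 0, walkPos_zero', add_zero] at this
    · have := h (m + 1) (by omega) (by omega)
      rwa [walkPos_cons s w m, ← add_assoc] at this
    · obtain ⟨j, rfl⟩ : ∃ j, m = j + 1 := ⟨m - 1, by omega⟩
      rw [walkPos_cons s w j, ← add_assoc]
      rcases Nat.eq_zero_or_pos j with rfl | hj
      · rw [walkPos_zero', add_zero]; exact h.1
      · exact h.2 j hj (by omega)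
  by_cases h0 : (v + (s : ℤ × ℤ)).2 = 0
  · rw [if_pos h0]
    refine Finset.sum_eq_zero fun w _ => if_neg fun h => ?_
    exact ((key w).1 h).1 h0
  · rw [if_neg h0]
    refine Finset.sum_congr rfl fun w _ => ?_
    refine if_congr ((key w).trans (and_iff_right h0)) rfl rfl

/-- Iterated killed kernel. -/
noncomputable def itK (t : ℝ) (g : ℤ → ℝ) : ℕ → ℤ → ℝ
  | 0, y => t / 2 * (g (y + 1) + g (y - 1))
  | n + 1, y => t / 2 * ((if y + 1 = 0 then 0 else itK t g n (y + 1)) +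
      (if y - 1 = 0 then 0 else itK t g n (y - 1)))

/-- Indicator of zero. -/
noncomputable def ind0 (y : ℤ) : ℝ := if y = 0 then 1 else 0

lemma itK_abs (t : ℝ) (ht : |t| ≤ 1) (g : ℤ → ℝ) (hg : ∀ y, |g y| ≤ 1) (n : ℕ) :
    ∀ y, |itK t g n y| ≤ |t| ^ (n + 1) := by
  have aux : ∀ a b c : ℝ, |a| ≤ c → |b| ≤ c → |t / 2 * (a + b)| ≤ |t| * c := by
    intro a b c ha hb
    rw [abs_mul, abs_div, abs_two]
    have := abs_add_le a b
    have h0 := abs_nonneg t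
    nlinarith
  induction n with
  | zero =>
    intro y
    have := aux _ _ _ (hg (y + 1)) (hg (y - 1))
    simpa [itK] using this
  | succ n ih =>
    intro y
    rw [itK, pow_succ' _ (n + 1)]
    have hp : 0 ≤ |t| ^ (n + 1) := by positivity
    apply aux
    · split_ifs
      · simpa using hp
      · exact ih _
    · split_ifs
      · simpa using hp
      · exact ih _

lemma itK_cont (g : ℤ → ℝ) (n : ℕ) : ∀ y, Continuous (fun t => itK t g n y) := by
  induction n with
  | zero => intro y; simp only [itK]; fun_prop
  | succ n ih =>
    intro y
    simp only [itK]
    refine Continuous.mul (by fun_prop) (Continuous.add ?_ ?_)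
    · split_ifs
      · exact continuous_const
      · exact ih _
    · split_ifs
      · exact continuous_const
      · exact ih _

lemma itK_dom (t : ℝ) (n : ℕ) : ∀ y, |itK t ind0 n y| ≤ itK |t| ind0 n y := by
  have aux : ∀ a b c d : ℝ, |a| ≤ c → |b| ≤ d → |t / 2 * (a + b)| ≤ |t| / 2 * (c + d) := by
    intro a b c d ha hb
    rw [abs_mul, abs_div, abs_two]
    have := abs_add_le a b
    have h0 := abs_nonneg t
    nlinarith
  have hi : ∀ y, |ind0 y| ≤ ind0 y := by
    intro y; unfold ind0; split_ifs <;> simp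
  induction n with
  | zero => intro y; exact aux _ _ _ _ (hi _) (hi _)
  | succ n ih =>
    intro y
    rw [itK, itK]
    apply aux
    · split_ifs
      · simp
      · exact ih _
    · split_ifs
      · simp
      · exact ih _

lemma harm (t l : ℝ) (h : t * (l ^ 2 + 1) = 2 * l) (y : ℤ) (hy : y ≠ 0) :
    t / 2 * (l ^ (y + 1).natAbs + l ^ (y - 1).natAbs) = l ^ y.natAbs := by
  rcases lt_or_gt_of_ne hy with h0 | h0
  · obtain ⟨j, hj⟩ : ∃ j : ℕ, y = -(j + 1) := ⟨(-y - 1).toNat, by omega⟩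
    have e1 : (y + 1).natAbs = j := by omega
    have e2 : (y - 1).natAbs = j + 2 := by omega
    have e3 : y.natAbs = j + 1 := by omega
    rw [e1, e2, e3]
    linear_combination l ^ j / 2 * h
  · obtain ⟨j, hj⟩ : ∃ j : ℕ, y = (j + 1) := ⟨(y - 1).toNat, by omega⟩
    have e1 : (y + 1).natAbs = j + 2 := by omega
    have e2 : (y - 1).natAbs = j := by omega
    have e3 : y.natAbs = j + 1 := by omega
    rw [e1, e2, e3]
    linear_combination l ^ j / 2 * h

lemma itK_rec (t l : ℝ) (h : t * (l ^ 2 + 1) = 2 * l) (n : ℕ) :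
    ∀ y, itK t (fun y => l ^ y.natAbs) n y =
      itK t ind0 n y + itK t (fun y => l ^ y.natAbs) (n + 1) y := by
  induction n with
  | zero =>
    intro y
    have aux : ∀ z : ℤ, l ^ z.natAbs =
        ind0 z + (if z = 0 then 0 else itK t (fun y => l ^ y.natAbs) 0 z) := by
      intro z
      unfold ind0
      split_ifs with hz
      · simp [hz]
      · rw [itK, harm t l h z hz, zero_add]
    rw [itK, itK, itK, aux (y + 1), aux (y - 1)]
    ring
  | succ n ih =>
    intro y
    have aux : ∀ z : ℤ, (if z = 0 then 0 else itK t (fun y => l ^ y.natAbs) n z) =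
        (if z = 0 then 0 else itK t ind0 n z) +
        (if z = 0 then 0 else itK t (fun y => l ^ y.natAbs) (n + 1) z) := by
      intro z
      split_ifs
      · simp
      · exact ih z
    rw [itK, itK, itK, aux (y + 1), aux (y - 1)]
    ring

lemma itK_hasSum (t l : ℝ) (h : t * (l ^ 2 + 1) = 2 * l) (hl : |l| ≤ 1) (ht : |t| < 1) :
    HasSum (fun n => itK t ind0 n 0) (t * l) := by
  have hpart : ∀ N, ∑ n ∈ range N, itK t ind0 n 0 =
      t * l - itK t (fun y => l ^ y.natAbs) N 0 := by
    intro N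
    induction N with
    | zero => simp [itK]; ring
    | succ N ih => rw [Finset.sum_range_succ, ih, itK_rec t l h N 0]; ring
  have hs : Summable (fun n => itK t ind0 n 0) := by
    refine Summable.of_norm_bounded (g := fun n => |t| ^ (n + 1)) ?_ fun n => ?_
    · exact (summable_nat_add_iff 1).2 (summable_geometric_of_lt_one (abs_nonneg t) ht)
    · refine itK_abs t ht.le ind0 ?_ n 0
      intro y; unfold ind0; split_ifs <;> simp
  refine (hs.hasSum_iff_tendsto_nat).2 ?_
  simp_rw [hpart]
  have h0 : Filter.Tendsto (fun N => itK t (fun y => l ^ y.natAbs) N 0) Filter.atTop (nhds 0) := by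
    refine squeeze_zero_norm (a := fun n => |t| ^ (n + 1)) ?_ ?_
    · intro n
      refine itK_abs t ht.le _ ?_ n 0
      intro y
      rw [abs_pow]
      exact pow_le_one₀ (abs_nonneg l) hl
    · exact (Filter.tendsto_add_atTop_iff_nat 1).2
        (tendsto_pow_atTop_nhds_zero_of_lt_one (abs_nonneg t) ht)
  simpa using h0.const_sub (t * l)

lemma itK_hasSum' (t s : ℝ) (h : s ^ 2 + t ^ 2 = 1) (hs : 0 < s) :
    HasSum (fun n => itK t ind0 n 0) (1 - s) := by
  have hs1 : s ≤ 1 := by nlinarith [sq_nonneg t]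
  have ht : |t| < 1 := by
    rw [← sq_lt_one_iff_abs_lt_one]; nlinarith
  by_cases h0 : t = 0
  · have hs1 : s = 1 := by subst h0; nlinarith
    have := itK_hasSum t 0 (by simp [h0]) (by simp) ht
    simpa [hs1] using this
  · have := itK_hasSum t ((1 - s) / t) (by field_simp; linear_combination h) ?_ ht
    · rwa [mul_div_cancel₀ _ h0] at this
    · rw [← sq_le_one_iff_abs_le_one, div_pow, div_le_one (by positivity)]
      nlinarith

lemma int_cos (m : ℤ) :
    ∫ θ in (0 : ℝ)..Real.pi, Real.cos (θ * m) = if m = 0 then Real.pi else 0 := by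
  split_ifs with h
  · simp [h]
  · have hm : (m : ℝ) ≠ 0 := by exact_mod_cast h
    rw [intervalIntegral.integral_comp_mul_right (fun x => Real.cos x) hm, integral_cos]
    rw [mul_comm Real.pi, Real.sin_int_mul_pi]
    simp

lemma dCnt_int (k : ℤ) (n : ℕ) : ∀ v : ℤ × ℤ,
    ∫ θ in (0 : ℝ)..Real.pi, Real.cos (θ * ((v.1 - 2 * k : ℤ) : ℝ)) *
      itK (Real.cos θ) ind0 n v.2 = Real.pi * (dCnt (n + 1) k v / 4 ^ (n + 1)) := by
  have ad : ∀ θ x : ℝ, Real.cos (θ * (x + 1)) + Real.cos (θ * (x - 1)) =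
      2 * Real.cos (θ * x) * Real.cos θ := by
    intro θ x
    rw [mul_add, mul_sub, mul_one, Real.cos_add, Real.cos_sub]; ring
  have gen : ∀ (G : ℝ → ℤ → ℝ) (hG : ∀ y, Continuous fun θ => G θ y) (v : ℤ × ℤ),
      ∫ θ in (0 : ℝ)..Real.pi, Real.cos (θ * ((v.1 - 2 * k : ℤ) : ℝ)) *
        (Real.cos θ / 2 * (G θ (v.2 + 1) + G θ (v.2 - 1))) =
      (∑ s : diamondSteps, ∫ θ in (0 : ℝ)..Real.pi,
        Real.cos (θ * (((v + (s : ℤ × ℤ)).1 - 2 * k : ℤ) : ℝ)) *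
          G θ (v + (s : ℤ × ℤ)).2) / 4 := by
    intro G hG v
    rw [← intervalIntegral.integral_finsetSum, ← intervalIntegral.integral_div]
    · refine intervalIntegral.integral_congr fun θ _ => ?_
      beta_reduce
      rw [sum_steps (fun s => Real.cos (θ * (((v + s).1 - 2 * k : ℤ) : ℝ)) * G θ (v + s).2)]
      have := ad θ ((v.1 - 2 * k : ℤ) : ℝ)
      simp only [Prod.fst_add, Prod.snd_add]
      have e1 : ((v.1 + 1 - 2 * k : ℤ) : ℝ) = ((v.1 - 2 * k : ℤ) : ℝ) + 1 := by push_cast; ring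
      have e2 : ((v.1 + -1 - 2 * k : ℤ) : ℝ) = ((v.1 - 2 * k : ℤ) : ℝ) - 1 := by push_cast; ring
      rw [e1, e2, ← sub_eq_add_neg v.2 1]
      linear_combination (-(G θ (v.2 + 1) + G θ (v.2 - 1)) / 4) * this
    · intro s _
      apply Continuous.intervalIntegrable
      exact Continuous.mul (by fun_prop) (hG _)
  induction n with
  | zero =>
    intro v
    simp only [itK]
    rw [gen (fun _ y => ind0 y) (fun y => continuous_const) v, zero_add, dCnt_one, pow_one,
      ← mul_div_assoc, Finset.mul_sum]
    congr 1
    refine Finset.sum_congr rfl fun s _ => ?_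
    rw [intervalIntegral.integral_mul_const, int_cos]
    unfold ind0
    simp only [Prod.ext_iff]
    generalize v + (s : ℤ × ℤ) = u
    by_cases h1 : u.1 = 2 * k <;> by_cases h2 : u.2 = 0 <;>
      simp [h1, h2, sub_eq_zero]
  | succ n ih =>
    intro v
    simp only [itK]
    rw [gen (fun θ y => if y = 0 then 0 else itK (Real.cos θ) ind0 n y) ?_ v, dCnt_succ,
      pow_succ _ (n + 1), ← mul_div_assoc, ← div_div, Finset.mul_sum]
    · congr 1
      rw [Finset.sum_div]
      refine Finset.sum_congr rfl fun s _ => ?_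
      split_ifs with h
      · simp
      · rw [ih, mul_div_assoc]
    · intro y
      split_ifs
      · exact continuous_const
      · exact (itK_cont ind0 n y).comp Real.continuous_cos

lemma final_int (k : ℤ) :
    ∫ θ in (0 : ℝ)..Real.pi, Real.cos (θ * ((0 - 2 * k : ℤ) : ℝ)) * (1 - Real.sin θ) =
      Real.pi * (if k = 0 then 1 - 2 / Real.pi
      else 2 / (Real.pi * (4 * (k : ℝ) ^ 2 - 1))) := by
  have hpi := Real.pi_ne_zero
  have hsin : ∀ m : ℤ, Odd m → ∫ θ in (0 : ℝ)..Real.pi, Real.sin (θ * m) = 2 / m := by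
    intro m hm
    have hm0 : (m : ℝ) ≠ 0 := by
      have : m ≠ 0 := by rintro rfl; simp at hm
      exact_mod_cast this
    rw [intervalIntegral.integral_comp_mul_right (fun x => Real.sin x) hm0, integral_sin]
    have : Real.cos (Real.pi * m) = -1 := by
      obtain ⟨j, rfl⟩ := hm
      have : Real.pi * ((2 * j + 1 : ℤ) : ℝ) = Real.pi + j * (2 * Real.pi) := by push_cast; ring
      rw [this, Real.cos_add_int_mul_two_pi, Real.cos_pi]
    rw [this]
    simp only [zero_mul, Real.cos_zero, smul_eq_mul]
    field_simp; norm_num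
  have e : ∀ θ : ℝ, Real.cos (θ * ((0 - 2 * k : ℤ) : ℝ)) * (1 - Real.sin θ) =
      Real.cos (θ * ((0 - 2 * k : ℤ) : ℝ)) -
      (Real.sin (θ * ((1 + 2 * k : ℤ) : ℝ)) + Real.sin (θ * ((1 - 2 * k : ℤ) : ℝ))) / 2 := by
    intro θ
    have h1 : θ * ((1 + 2 * k : ℤ) : ℝ) = θ + θ * (2 * k) := by push_cast; ring
    have h2 : θ * ((1 - 2 * k : ℤ) : ℝ) = θ - θ * (2 * k) := by push_cast; ring
    have h3 : θ * ((0 - 2 * k : ℤ) : ℝ) = - (θ * (2 * k)) := by push_cast; ring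
    rw [h1, h2, h3, Real.cos_neg, Real.sin_add, Real.sin_sub]; ring
  simp_rw [e]
  rw [intervalIntegral.integral_sub, intervalIntegral.integral_div, intervalIntegral.integral_add,
    int_cos, hsin _ ⟨k, by ring⟩, hsin _ ⟨-k, by ring⟩]
  · by_cases hk : k = 0
    · subst hk; simp; field_simp
    · have h1 : (1 + 2 * (k : ℝ)) ≠ 0 := by
        have : (1 + 2 * k : ℤ) ≠ 0 := by omega
        exact_mod_cast this
      have h2 : (1 - 2 * (k : ℝ)) ≠ 0 := by
        have : (1 - 2 * k : ℤ) ≠ 0 := by omega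
        exact_mod_cast this
      have h3 : (4 * (k : ℝ) ^ 2 - 1) ≠ 0 := by
        have := mul_ne_zero h1 h2
        intro h; apply this; linear_combination -h
      have h4 : ¬ (0 - 2 * k = 0) := by omega
      rw [if_neg hk, if_neg h4]
      have h5 : Real.pi * (2 / (Real.pi * (4 * (k : ℝ) ^ 2 - 1))) =
          -2 / ((1 + 2 * (k : ℝ)) * (1 - 2 * (k : ℝ))) := by
        rw [← mul_div_assoc, mul_div_mul_left _ _ hpi, div_eq_div_iff h3 (mul_ne_zero h1 h2)]
        ring
      rw [h5]
      push_cast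
      field_simp
      ring
  all_goals
    apply Continuous.intervalIntegrable
    fun_prop

/-- For the simple random walk on the diamond graph started at the origin, the
probability that at its first return time to the horizontal axis `ℤ × {0}` it
lands at the point `(k,0)` equals `2/(π(4k²−1))` for `k ≠ 0`, and `1 − 2/π`
for `k = 0`. Each length-`n` step sequence has probability `4^{-n}`. -/
theorem diamond_first_return_distribution (k : ℤ) :
    (∑' n : ℕ, (firstReturnCount (n + 1) k : ℝ) / 4 ^ (n + 1)) =
      if k = 0 then 1 - 2 / Real.pi
      else 2 / (Real.pi * (4 * (k : ℝ) ^ 2 - 1)) := by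
  have hae : ∀ᵐ θ : ℝ, θ ∈ Set.uIoc 0 Real.pi → 0 < Real.sin θ := by
    have : ∀ᵐ θ : ℝ, θ ≠ Real.pi := by simp [MeasureTheory.ae_iff]
    filter_upwards [this] with θ h1 h2
    rw [Set.uIoc_of_le Real.pi_pos.le] at h2
    exact Real.sin_pos_of_pos_of_lt_pi h2.1 (lt_of_le_of_ne h2.2 h1)
  have hs : ∀ θ : ℝ, 0 < Real.sin θ →
      HasSum (fun n => itK |Real.cos θ| ind0 n 0) (1 - Real.sin θ) := fun θ h =>
    itK_hasSum' _ _ (by rw [sq_abs]; exact Real.sin_sq_add_cos_sq θ) h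
  have H := intervalIntegral.hasSum_integral_of_dominated_convergence
    (μ := MeasureTheory.volume) (a := 0) (b := Real.pi)
    (F := fun (n : ℕ) (θ : ℝ) => Real.cos (θ * ((0 - 2 * k : ℤ) : ℝ)) *
      itK (Real.cos θ) ind0 n 0)
    (f := fun θ => Real.cos (θ * ((0 - 2 * k : ℤ) : ℝ)) * (1 - Real.sin θ))
    (fun n θ => itK |Real.cos θ| ind0 n 0)
    (fun n => by
      apply Continuous.aestronglyMeasurable
      exact Continuous.mul (by fun_prop) ((itK_cont ind0 n 0).comp Real.continuous_cos))
    (fun n => by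
      refine Filter.Eventually.of_forall fun θ _ => ?_
      rw [norm_mul]
      refine (mul_le_of_le_one_left (norm_nonneg _) (Real.abs_cos_le_one _)).trans ?_
      exact itK_dom _ _ _)
    (by filter_upwards [hae] with θ h1 h2 using (hs θ (h1 h2)).summable)
    (by
      have : IntervalIntegrable (fun θ => 1 - Real.sin θ) MeasureTheory.volume 0 Real.pi := by
        apply Continuous.intervalIntegrable
        fun_prop
      refine this.congr_ae ?_
      rw [Filter.EventuallyEq, MeasureTheory.ae_restrict_iff' measurableSet_uIoc]
      filter_upwards [hae] with θ h1 h2 using (hs θ (h1 h2)).tsum_eq.symm)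
    (by
      filter_upwards [hae] with θ h1 h2
      exact (itK_hasSum' _ _ (Real.sin_sq_add_cos_sq θ) (h1 h2)).mul_left _)
  rw [final_int] at H
  have e : ∀ n : ℕ, ∫ θ in (0 : ℝ)..Real.pi, Real.cos (θ * ((0 - 2 * k : ℤ) : ℝ)) *
      itK (Real.cos θ) ind0 n 0 = Real.pi * ((firstReturnCount (n + 1) k : ℝ) / 4 ^ (n + 1)) := by
    intro n
    rw [dCnt_eq]
    exact dCnt_int k n 0
  simp_rw [e] at H
  exact ((hasSum_mul_left_iff Real.pi_ne_zero).1 H).tsum_eq
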